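/- Let C be the projective variety in \u2119\u00b3 cut out by the two homogeneous polynomials XY + T\u00b2 and TX\u00b2 + Y\u00b3 + X\u00b2Z + Z\u00b3 (with coefficients 0,1). Then: for every finite field K with |K| = 2, C has exactly 5 K-points; for every finite field K with |K| = 4, C has exactly 9 K-points; for every finite field K with |K| = 8, C has exactly 11 K-points; and for every finite field K with |K| = 16, C has exactly 25 K-points. -/

import Mathlib

open MvPolynomial

/-- The quadric cone `XY + T²` in `ℙ³`. -/
noncomputable def quadF (K : Type) [Field K] : MvPolynomial (Fin 4) K :=
  X 0 * X 1 + X 3 ^ 2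

/-- The cubic `TX² + Y³ + X²Z + Z³`. -/
noncomputable def cubicG (K : Type) [Field K] : MvPolynomial (Fin 4) K :=
  X 3 * X 0 ^ 2 + X 1 ^ 3 + X 0 ^ 2 * X 2 + X 2 ^ 3

/-- The set of `K`-points of the projective variety `V(f, g) ⊆ ℙ³`. -/
def projPoints (K : Type) [Field K] (f g : MvPolynomial (Fin 4) K) : Type :=
  {p : Projectivization K (Fin 4 → K) //
    MvPolynomial.eval p.rep f = 0 ∧ MvPolynomial.eval p.rep g = 0}

namespace CurveCount

/-- The polynomial equations, as explicit conditions on a vector. -/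
def OnCurve {K : Type} [Field K] (v : Fin 4 → K) : Prop :=
  v 0 * v 1 + v 3 ^ 2 = 0 ∧ v 3 * v 0 ^ 2 + v 1 ^ 3 + v 0 ^ 2 * v 2 + v 2 ^ 3 = 0

lemma onCurve_eval {K : Type} [Field K] (v : Fin 4 → K) :
    (MvPolynomial.eval v (quadF K) = 0 ∧ MvPolynomial.eval v (cubicG K) = 0) ↔ OnCurve v := by
  simp [quadF, cubicG, OnCurve]

lemma onCurve_smul {K : Type} [Field K] (a : Kˣ) (v : Fin 4 → K) :
    OnCurve (a • v) ↔ OnCurve v := by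
  have ha : (a : K) ≠ 0 := a.ne_zero
  have e1 : (a • v) 0 * (a • v) 1 + (a • v) 3 ^ 2 = (a : K) ^ 2 * (v 0 * v 1 + v 3 ^ 2) := by
    simp only [Pi.smul_apply, Units.smul_def, smul_eq_mul]; ring
  have e2 : (a • v) 3 * (a • v) 0 ^ 2 + (a • v) 1 ^ 3 + (a • v) 0 ^ 2 * (a • v) 2 + (a • v) 2 ^ 3
      = (a : K) ^ 3 * (v 3 * v 0 ^ 2 + v 1 ^ 3 + v 0 ^ 2 * v 2 + v 2 ^ 3) := by
    simp only [Pi.smul_apply, Units.smul_def, smul_eq_mul]; ring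
  unfold OnCurve
  rw [e1, e2]
  simp [ha]

lemma onCurve_rep {K : Type} [Field K] (v : Fin 4 → K) (hv : v ≠ 0) :
    OnCurve (Projectivization.mk K v hv).rep ↔ OnCurve v := by
  obtain ⟨a, ha⟩ := Projectivization.exists_smul_eq_mk_rep K v hv
  rw [← ha, onCurve_smul]

/-- Affine part (`X = 1`). -/
abbrev Aff (K : Type) [CommRing K] : Type :=
  {p : K × K // p.1 + (-(p.1 * p.1)) * (p.1 * p.1) * (p.1 * p.1) + p.2 + p.2 * p.2 * p.2 = 0}

/-- Part at infinity (`X = 0`, `Y = 1`). -/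
abbrev Inf (K : Type) [CommRing K] : Type := {z : K // 1 + z * z * z = 0}

lemma affNe {K : Type} [Field K] (t z : K) : (![1, -(t * t), z, t] : Fin 4 → K) ≠ 0 := by
  intro h
  simpa using congrFun h 0

lemma infNe {K : Type} [Field K] (z : K) : (![0, 1, z, 0] : Fin 4 → K) ≠ 0 := by
  intro h
  simpa using congrFun h 1

/-- Parametrization of the points. -/
noncomputable def toPts (K : Type) [Field K] : Aff K ⊕ Inf K → projPoints K (quadF K) (cubicG K)
  | .inl p => ⟨Projectivization.mk K _ (affNe p.1.1 p.1.2), by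
      rw [onCurve_eval, onCurve_rep]
      have h := p.2
      refine ⟨?_, ?_⟩
      · simp; ring
      · simp; linear_combination h⟩
  | .inr z => ⟨Projectivization.mk K _ (infNe z.1), by
      rw [onCurve_eval, onCurve_rep]
      have h := z.2
      refine ⟨?_, ?_⟩
      · simp
      · simp; linear_combination h⟩

lemma toPts_bij (K : Type) [Field K] : Function.Bijective (toPts K) := by
  constructor
  · rintro (⟨⟨t, z⟩, h⟩ | ⟨z, h⟩) (⟨⟨t', z'⟩, h'⟩ | ⟨z', h'⟩) e
    all_goals
      have e := congrArg Subtype.val e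
      simp only [toPts] at e
      rw [Projectivization.mk_eq_mk_iff'] at e
      obtain ⟨a, ha⟩ := e
      have h0 := congrFun ha 0
      have h1 := congrFun ha 1
      have h2 := congrFun ha 2
      have h3 := congrFun ha 3
      simp at h0 h1 h2 h3
    · subst h0; simp at h2 h3; simp [h2, h3]
    · subst h0; simp at h1
    · subst h1; simp at h2; simp [h2]
  · rintro ⟨p, hp⟩
    rw [onCurve_eval] at hp
    obtain ⟨q1, q2⟩ := hp
    suffices hs : ∃ a, (toPts K a).1 = p by
      obtain ⟨a, ha⟩ := hs
      exact ⟨a, Subtype.ext ha⟩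
    obtain ⟨v, hne, hmk, q1, q2⟩ : ∃ v : Fin 4 → K, ∃ hne : v ≠ 0,
        Projectivization.mk K v hne = p ∧ v 0 * v 1 + v 3 ^ 2 = 0 ∧
        v 3 * v 0 ^ 2 + v 1 ^ 3 + v 0 ^ 2 * v 2 + v 2 ^ 3 = 0 :=
      ⟨p.rep, p.rep_nonzero, p.mk_rep, q1, q2⟩
    by_cases h0 : v 0 = 0
    · have h3 : v 3 = 0 := by simpa [h0] using q1
      have q2 : v 1 ^ 3 + v 2 ^ 3 = 0 := by simpa [h0] using q2
      have h1 : v 1 ≠ 0 := by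
        intro h1
        have h2 : v 2 = 0 := by simpa [h1] using q2
        apply hne
        ext i; fin_cases i <;> simp [h0, h1, h2, h3]
      refine ⟨.inr ⟨v 2 / v 1, ?_⟩, ?_⟩
      · field_simp; linear_combination q2
      · simp only [toPts]
        rw [← hmk, Projectivization.mk_eq_mk_iff']
        refine ⟨(v 1)⁻¹, ?_⟩
        ext i; fin_cases i <;> simp [h0, h1, h3]
        field_simp
    · have q1' : v 1 = - (v 3 ^ 2) / v 0 := by
        field_simp; linear_combination q1
      refine ⟨.inl ⟨(v 3 / v 0, v 2 / v 0), ?_⟩, ?_⟩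
      · rw [q1'] at q2
        field_simp at q2 ⊢
        linear_combination q2
      · simp only [toPts]
        rw [← hmk, Projectivization.mk_eq_mk_iff']
        refine ⟨(v 0)⁻¹, ?_⟩
        ext i; fin_cases i <;> simp [h0, q1'] <;> field_simp

/-- Transfer of the count to a model field. -/
lemma card_model (K L : Type) [Field K] [Fintype K] [Field L] [Fintype L] [DecidableEq L]
    (h : Fintype.card K = Fintype.card L) :
    Nat.card (projPoints K (quadF K) (cubicG K)) = Fintype.card (Aff L) + Fintype.card (Inf L) := by
  have e : K ≃+* L := FiniteField.ringEquivOfCardEq h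
  rw [← Nat.card_congr (Equiv.ofBijective _ (toPts_bij K)), ← Fintype.card_sum,
    ← Nat.card_eq_fintype_card]
  refine Nat.card_congr (Equiv.sumCongr ?_ ?_)
  · refine Equiv.subtypeEquiv (Equiv.prodCongr e.toEquiv e.toEquiv) ?_
    rintro ⟨t, z⟩
    rw [← e.map_eq_zero_iff]
    simp
  · refine Equiv.subtypeEquiv e.toEquiv ?_
    intro z
    rw [← e.map_eq_zero_iff]
    simp

/-- Quadruples: coordinates in the basis `1, x, x², x³`. -/
@[ext] structure Quad where
  a : ZMod 2
  b : ZMod 2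
  c : ZMod 2
  d : ZMod 2

/-- Triples: coordinates in the basis `1, x, x²`. -/
@[ext] structure Trip where
  a : ZMod 2
  b : ZMod 2
  c : ZMod 2

/-- Pairs: coordinates in the basis `1, x`. -/
@[ext] structure Duo where
  a : ZMod 2
  b : ZMod 2

instance : DecidableEq Quad := fun p q =>
  decidable_of_iff (p.a = q.a ∧ p.b = q.b ∧ p.c = q.c ∧ p.d = q.d) Quad.ext_iff.symm
instance : DecidableEq Trip := fun p q =>
  decidable_of_iff (p.a = q.a ∧ p.b = q.b ∧ p.c = q.c) Trip.ext_iff.symm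
instance : DecidableEq Duo := fun p q =>
  decidable_of_iff (p.a = q.a ∧ p.b = q.b) Duo.ext_iff.symm

instance : Fintype Quad := Fintype.ofEquiv (ZMod 2 × ZMod 2 × ZMod 2 × ZMod 2)
  ⟨fun p => ⟨p.1, p.2.1, p.2.2.1, p.2.2.2⟩, fun q => (q.a, q.b, q.c, q.d), fun _ => rfl, fun _ => rfl⟩
instance : Fintype Trip := Fintype.ofEquiv (ZMod 2 × ZMod 2 × ZMod 2)
  ⟨fun p => ⟨p.1, p.2.1, p.2.2⟩, fun q => (q.a, q.b, q.c), fun _ => rfl, fun _ => rfl⟩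
instance : Fintype Duo := Fintype.ofEquiv (ZMod 2 × ZMod 2)
  ⟨fun p => ⟨p.1, p.2⟩, fun q => (q.a, q.b), fun _ => rfl, fun _ => rfl⟩

/-! The field `𝔽₂[x]` modulo `x⁴ = x + 1`. -/

instance : Zero Quad := ⟨⟨0, 0, 0, 0⟩⟩
instance : One Quad := ⟨⟨1, 0, 0, 0⟩⟩
instance : Add Quad := ⟨fun p q => ⟨p.a + q.a, p.b + q.b, p.c + q.c, p.d + q.d⟩⟩
instance : Neg Quad := ⟨fun p => ⟨-p.a, -p.b, -p.c, -p.d⟩⟩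
instance : Mul Quad := ⟨fun p q =>
    ⟨p.a * q.a + (p.b * q.d + p.c * q.c + p.d * q.b),
     p.a * q.b + p.b * q.a + (p.b * q.d + p.c * q.c + p.d * q.b) + (p.c * q.d + p.d * q.c),
     p.a * q.c + p.b * q.b + p.c * q.a + (p.c * q.d + p.d * q.c) + p.d * q.d,
     p.a * q.d + p.b * q.c + p.c * q.b + p.d * q.a + p.d * q.d⟩⟩

@[simp] lemma Quad.zero_a : (0 : Quad).a = 0 := rfl
@[simp] lemma Quad.one_a : (1 : Quad).a = 1 := rfl
@[simp] lemma Quad.add_a (p q : Quad) : (p + q).a = p.a + q.a := rfl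
@[simp] lemma Quad.neg_a (p : Quad) : (-p).a = -p.a := rfl
@[simp] lemma Quad.mul_a (p q : Quad) : (p * q).a = p.a * q.a + (p.b * q.d + p.c * q.c + p.d * q.b) := rfl
@[simp] lemma Quad.zero_b : (0 : Quad).b = 0 := rfl
@[simp] lemma Quad.one_b : (1 : Quad).b = 0 := rfl
@[simp] lemma Quad.add_b (p q : Quad) : (p + q).b = p.b + q.b := rfl
@[simp] lemma Quad.neg_b (p : Quad) : (-p).b = -p.b := rfl
@[simp] lemma Quad.mul_b (p q : Quad) : (p * q).b = p.a * q.b + p.b * q.a + (p.b * q.d + p.c * q.c + p.d * q.b) + (p.c * q.d + p.d * q.c) := rfl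
@[simp] lemma Quad.zero_c : (0 : Quad).c = 0 := rfl
@[simp] lemma Quad.one_c : (1 : Quad).c = 0 := rfl
@[simp] lemma Quad.add_c (p q : Quad) : (p + q).c = p.c + q.c := rfl
@[simp] lemma Quad.neg_c (p : Quad) : (-p).c = -p.c := rfl
@[simp] lemma Quad.mul_c (p q : Quad) : (p * q).c = p.a * q.c + p.b * q.b + p.c * q.a + (p.c * q.d + p.d * q.c) + p.d * q.d := rfl
@[simp] lemma Quad.zero_d : (0 : Quad).d = 0 := rfl
@[simp] lemma Quad.one_d : (1 : Quad).d = 0 := rfl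
@[simp] lemma Quad.add_d (p q : Quad) : (p + q).d = p.d + q.d := rfl
@[simp] lemma Quad.neg_d (p : Quad) : (-p).d = -p.d := rfl
@[simp] lemma Quad.mul_d (p q : Quad) : (p * q).d = p.a * q.d + p.b * q.c + p.c * q.b + p.d * q.a + p.d * q.d := rfl

instance : CommRing Quad where
  add_assoc _ _ _ := by ext <;> simp [add_assoc]
  zero_add _ := by ext <;> simp
  add_zero _ := by ext <;> simp
  add_comm _ _ := by ext <;> simp [add_comm]
  neg_add_cancel _ := by ext <;> simp only [Quad.add_a, Quad.add_b, Quad.add_c, Quad.add_d, Quad.neg_a, Quad.neg_b, Quad.neg_c, Quad.neg_d, Quad.zero_a, Quad.zero_b, Quad.zero_c, Quad.zero_d] <;> exact neg_add_cancel _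
  nsmul := nsmulRec
  zsmul := zsmulRec
  left_distrib _ _ _ := by ext <;> simp <;> ring
  right_distrib _ _ _ := by ext <;> simp <;> ring
  zero_mul _ := by ext <;> simp
  mul_zero _ := by ext <;> simp
  mul_assoc _ _ _ := by ext <;> simp <;> ring
  one_mul _ := by ext <;> simp
  mul_one _ := by ext <;> simp
  mul_comm _ _ := by ext <;> simp <;> ring

instance : Field Quad where
  inv p := (p * p) * ((p * p) * (p * p)) * (((p * p) * (p * p)) * ((p * p) * (p * p)))
  exists_pair_ne := ⟨0, 1, by decide +kernel⟩
  mul_inv_cancel := by decide +kernel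
  inv_zero := by decide +kernel
  nnqsmul := _
  nnqsmul_def := fun _ _ => rfl
  qsmul := _
  qsmul_def := fun _ _ => rfl

/-! The field `𝔽₂[x]` modulo `x³ = x + 1`. -/

instance : Zero Trip := ⟨⟨0, 0, 0⟩⟩
instance : One Trip := ⟨⟨1, 0, 0⟩⟩
instance : Add Trip := ⟨fun p q => ⟨p.a + q.a, p.b + q.b, p.c + q.c⟩⟩
instance : Neg Trip := ⟨fun p => ⟨-p.a, -p.b, -p.c⟩⟩
instance : Mul Trip := ⟨fun p q =>
    ⟨p.a * q.a + (p.b * q.c + p.c * q.b),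
     p.a * q.b + p.b * q.a + (p.b * q.c + p.c * q.b) + p.c * q.c,
     p.a * q.c + p.b * q.b + p.c * q.a + p.c * q.c⟩⟩

@[simp] lemma Trip.zero_a : (0 : Trip).a = 0 := rfl
@[simp] lemma Trip.one_a : (1 : Trip).a = 1 := rfl
@[simp] lemma Trip.add_a (p q : Trip) : (p + q).a = p.a + q.a := rfl
@[simp] lemma Trip.neg_a (p : Trip) : (-p).a = -p.a := rfl
@[simp] lemma Trip.mul_a (p q : Trip) : (p * q).a = p.a * q.a + (p.b * q.c + p.c * q.b) := rfl
@[simp] lemma Trip.zero_b : (0 : Trip).b = 0 := rfl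
@[simp] lemma Trip.one_b : (1 : Trip).b = 0 := rfl
@[simp] lemma Trip.add_b (p q : Trip) : (p + q).b = p.b + q.b := rfl
@[simp] lemma Trip.neg_b (p : Trip) : (-p).b = -p.b := rfl
@[simp] lemma Trip.mul_b (p q : Trip) : (p * q).b = p.a * q.b + p.b * q.a + (p.b * q.c + p.c * q.b) + p.c * q.c := rfl
@[simp] lemma Trip.zero_c : (0 : Trip).c = 0 := rfl
@[simp] lemma Trip.one_c : (1 : Trip).c = 0 := rfl
@[simp] lemma Trip.add_c (p q : Trip) : (p + q).c = p.c + q.c := rfl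
@[simp] lemma Trip.neg_c (p : Trip) : (-p).c = -p.c := rfl
@[simp] lemma Trip.mul_c (p q : Trip) : (p * q).c = p.a * q.c + p.b * q.b + p.c * q.a + p.c * q.c := rfl

instance : CommRing Trip where
  add_assoc _ _ _ := by ext <;> simp [add_assoc]
  zero_add _ := by ext <;> simp
  add_zero _ := by ext <;> simp
  add_comm _ _ := by ext <;> simp [add_comm]
  neg_add_cancel _ := by ext <;> simp only [Trip.add_a, Trip.add_b, Trip.add_c, Trip.neg_a, Trip.neg_b, Trip.neg_c, Trip.zero_a, Trip.zero_b, Trip.zero_c] <;> exact neg_add_cancel _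
  nsmul := nsmulRec
  zsmul := zsmulRec
  left_distrib _ _ _ := by ext <;> simp <;> ring
  right_distrib _ _ _ := by ext <;> simp <;> ring
  zero_mul _ := by ext <;> simp
  mul_zero _ := by ext <;> simp
  mul_assoc _ _ _ := by ext <;> simp <;> ring
  one_mul _ := by ext <;> simp
  mul_one _ := by ext <;> simp
  mul_comm _ _ := by ext <;> simp <;> ring

instance : Field Trip where
  inv p := (p * p) * ((p * p) * (p * p))
  exists_pair_ne := ⟨0, 1, by decide +kernel⟩
  mul_inv_cancel := by decide +kernel
  inv_zero := by decide +kernel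
  nnqsmul := _
  nnqsmul_def := fun _ _ => rfl
  qsmul := _
  qsmul_def := fun _ _ => rfl

/-! The field `𝔽₂[x]` modulo `x² = x + 1`. -/

instance : Zero Duo := ⟨⟨0, 0⟩⟩
instance : One Duo := ⟨⟨1, 0⟩⟩
instance : Add Duo := ⟨fun p q => ⟨p.a + q.a, p.b + q.b⟩⟩
instance : Neg Duo := ⟨fun p => ⟨-p.a, -p.b⟩⟩
instance : Mul Duo := ⟨fun p q =>
    ⟨p.a * q.a + p.b * q.b,
     p.a * q.b + p.b * q.a + p.b * q.b⟩⟩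

@[simp] lemma Duo.zero_a : (0 : Duo).a = 0 := rfl
@[simp] lemma Duo.one_a : (1 : Duo).a = 1 := rfl
@[simp] lemma Duo.add_a (p q : Duo) : (p + q).a = p.a + q.a := rfl
@[simp] lemma Duo.neg_a (p : Duo) : (-p).a = -p.a := rfl
@[simp] lemma Duo.mul_a (p q : Duo) : (p * q).a = p.a * q.a + p.b * q.b := rfl
@[simp] lemma Duo.zero_b : (0 : Duo).b = 0 := rfl
@[simp] lemma Duo.one_b : (1 : Duo).b = 0 := rfl
@[simp] lemma Duo.add_b (p q : Duo) : (p + q).b = p.b + q.b := rfl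
@[simp] lemma Duo.neg_b (p : Duo) : (-p).b = -p.b := rfl
@[simp] lemma Duo.mul_b (p q : Duo) : (p * q).b = p.a * q.b + p.b * q.a + p.b * q.b := rfl

instance : CommRing Duo where
  add_assoc _ _ _ := by ext <;> simp [add_assoc]
  zero_add _ := by ext <;> simp
  add_zero _ := by ext <;> simp
  add_comm _ _ := by ext <;> simp [add_comm]
  neg_add_cancel _ := by ext <;> simp only [Duo.add_a, Duo.add_b, Duo.neg_a, Duo.neg_b, Duo.zero_a, Duo.zero_b] <;> exact neg_add_cancel _
  nsmul := nsmulRec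
  zsmul := zsmulRec
  left_distrib _ _ _ := by ext <;> simp <;> ring
  right_distrib _ _ _ := by ext <;> simp <;> ring
  zero_mul _ := by ext <;> simp
  mul_zero _ := by ext <;> simp
  mul_assoc _ _ _ := by ext <;> simp <;> ring
  one_mul _ := by ext <;> simp
  mul_one _ := by ext <;> simp
  mul_comm _ _ := by ext <;> simp <;> ring

instance : Field Duo where
  inv p := p * p
  exists_pair_ne := ⟨0, 1, by decide +kernel⟩
  mul_inv_cancel := by decide +kernel
  inv_zero := by decide +kernel
  nnqsmul := _
  nnqsmul_def := fun _ _ => rfl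
  qsmul := _
  qsmul_def := fun _ _ => rfl

end CurveCount

theorem stmt2 :
    (∀ (K : Type) [Field K] [Fintype K], Fintype.card K = 2 →
      Nat.card (projPoints K (quadF K) (cubicG K)) = 5) ∧
    (∀ (K : Type) [Field K] [Fintype K], Fintype.card K = 4 →
      Nat.card (projPoints K (quadF K) (cubicG K)) = 9) ∧
    (∀ (K : Type) [Field K] [Fintype K], Fintype.card K = 8 →
      Nat.card (projPoints K (quadF K) (cubicG K)) = 11) ∧
    (∀ (K : Type) [Field K] [Fintype K], Fintype.card K = 16 →
      Nat.card (projPoints K (quadF K) (cubicG K)) = 25) := by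
  refine ⟨?_, ?_, ?_, ?_⟩ <;> intro K _ _ hK
  · rw [CurveCount.card_model K (ZMod 2) (hK.trans (by decide +kernel))]
    decide +kernel
  · rw [CurveCount.card_model K (CurveCount.Duo) (hK.trans (by decide +kernel))]
    decide +kernel
  · rw [CurveCount.card_model K (CurveCount.Trip) (hK.trans (by decide +kernel))]
    decide +kernel
  · rw [CurveCount.card_model K (CurveCount.Quad) (hK.trans (by decide +kernel))]
    decide +kernel
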